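/- arXiv:1604.03655 — 2 statements merged into one kernel-verified Lean document; each statement's English description precedes it below -/
import Mathlib

section
/- For every n ≥ 1 and every family of nonatomic Borel probability measures μ_1, …, μ_n on the unit interval [0,1], there exists a measurable partition X_1, …, X_n of [0,1] such that μ_i(X_i) ≥ μ_i(X_j) for all i and j; that is, an envy-free allocation of the whole cake among the n agents always exists. (This is the existence content of the Main Protocol allocating all the cake in an envy-free manner.) -/
open MeasureTheory

section ExactDivision

open Set Filter Topology

variable {X : Type*}

/-- The increasing dyadic families of subsets of `S` obtained by repeatedly inserting the part `h`
of each difference of consecutive sets. -/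
def dyadicChain (h : Set X → Set X) (S : Set X) : ℕ → ℕ → Set X
  | 0, j => if j = 0 then ∅ else S
  | m + 1, j =>
    if Even j then dyadicChain h S m (j / 2)
    else dyadicChain h S m (j / 2) ∪
      h (dyadicChain h S m (j / 2 + 1) \ dyadicChain h S m (j / 2))

theorem dyadicChain_succ_two_mul (h : Set X → Set X) (S : Set X) (m j : ℕ) :
    dyadicChain h S (m + 1) (2 * j) = dyadicChain h S m j := by
  simp [dyadicChain]

theorem dyadicChain_succ_two_mul_add_one (h : Set X → Set X) (S : Set X) (m j : ℕ) :
    dyadicChain h S (m + 1) (2 * j + 1) = dyadicChain h S m j ∪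
      h (dyadicChain h S m (j + 1) \ dyadicChain h S m j) := by
  have : (2 * j + 1) / 2 = j := by omega
  simp [dyadicChain, this]

theorem dyadicChain_zero_right (h : Set X → Set X) (S : Set X) (m : ℕ) :
    dyadicChain h S m 0 = ∅ := by
  induction m with
  | zero => simp [dyadicChain]
  | succ m ih => simpa [ih] using dyadicChain_succ_two_mul h S m 0

theorem dyadicChain_two_pow (h : Set X → Set X) (S : Set X) (m : ℕ) :
    dyadicChain h S m (2 ^ m) = S := by
  induction m with
  | zero => simp [dyadicChain]
  | succ m ih => rw [pow_succ', dyadicChain_succ_two_mul, ih]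

variable [MeasurableSpace X]

theorem measurableSet_dyadicChain {h : Set X → Set X} {S : Set X} (hS : MeasurableSet S)
    (hh : ∀ T, MeasurableSet T → MeasurableSet (h T)) (m j : ℕ) :
    MeasurableSet (dyadicChain h S m j) := by
  induction m generalizing j with
  | zero => by_cases hj : j = 0 <;> simp [dyadicChain, hj, hS]
  | succ m ih =>
    obtain ⟨k, rfl | rfl⟩ := j.even_or_odd'
    · rw [dyadicChain_succ_two_mul]
      exact ih k
    · rw [dyadicChain_succ_two_mul_add_one]
      exact (ih k).union (hh _ ((ih _).diff (ih _)))

theorem dyadicChain_mono {h : Set X → Set X} {S : Set X} (hS : MeasurableSet S)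
    (hh : ∀ T, MeasurableSet T → MeasurableSet (h T))
    (hsub : ∀ T, MeasurableSet T → h T ⊆ T) (m : ℕ) :
    Monotone (dyadicChain h S m) := by
  induction m with
  | zero =>
    refine monotone_nat_of_le_succ fun j => ?_
    by_cases hj : j = 0 <;> simp [dyadicChain, hj]
  | succ m ih =>
    refine monotone_nat_of_le_succ fun j => ?_
    have hmeas := measurableSet_dyadicChain hS hh m
    obtain ⟨k, rfl | rfl⟩ := j.even_or_odd'
    · rw [dyadicChain_succ_two_mul, dyadicChain_succ_two_mul_add_one]
      exact subset_union_left
    · rw [show 2 * k + 1 + 1 = 2 * (k + 1) by ring, dyadicChain_succ_two_mul,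
        dyadicChain_succ_two_mul_add_one]
      exact union_subset (ih k.le_succ)
        ((hsub _ ((hmeas _).diff (hmeas _))).trans sdiff_subset)

theorem measureReal_dyadicChain {h : Set X → Set X} {S : Set X} (hS : MeasurableSet S)
    (hh : ∀ T, MeasurableSet T → MeasurableSet (h T))
    (hsub : ∀ T, MeasurableSet T → h T ⊆ T) (μ : Measure X) [IsFiniteMeasure μ]
    (hμ : ∀ T, MeasurableSet T → μ.real (h T) = μ.real T / 2) (m j : ℕ) (hj : j ≤ 2 ^ m) :
    μ.real (dyadicChain h S m j) = j / 2 ^ m * μ.real S := by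
  induction m generalizing j with
  | zero =>
    obtain rfl | rfl : j = 0 ∨ j = 1 := by
      rw [pow_zero] at hj
      omega
    all_goals simp [dyadicChain]
  | succ m ih =>
    rw [pow_succ'] at hj
    have hmeas := measurableSet_dyadicChain hS hh m
    obtain ⟨k, rfl | rfl⟩ := j.even_or_odd'
    · rw [dyadicChain_succ_two_mul, ih k (by omega)]
      push_cast
      field_simp
      ring
    · have hd := (hmeas (k + 1)).diff (hmeas k)
      rw [dyadicChain_succ_two_mul_add_one,
        measureReal_union (disjoint_sdiff_right.mono_right (hsub _ hd)) (hh _ hd), hμ _ hd,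
        measureReal_sdiff (dyadicChain_mono hS hh hsub m k.le_succ) (hmeas k),
        ih k (by omega), ih (k + 1) (by omega)]
      push_cast
      field_simp
      ring

/-- Every measurable set has a measurable subset that is half of it for all measures in `M`. -/
def Halvable (M : Set (Measure X)) : Prop :=
  ∀ S, MeasurableSet S → ∃ B ⊆ S, MeasurableSet B ∧ ∀ μ ∈ M, μ.real B = μ.real S / 2

/-- If all measures in `M` can be halved simultaneously, then every measurable set has a chain
of measurable subsets, indexed by `[0, 1]`, along which all measures in `M` grow linearly. -/
theorem Halvable.exists_chain {M : Set (Measure X)} (hM : Halvable M)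
    (hfin : ∀ μ ∈ M, IsFiniteMeasure μ) {S : Set X} (hS : MeasurableSet S) :
    ∃ A : ℝ → Set X, Monotone A ∧ (∀ t, MeasurableSet (A t)) ∧ A 0 = ∅ ∧ A 1 = S ∧
      ∀ μ ∈ M, ∀ t ∈ Icc (0 : ℝ) 1, μ.real (A t) = t * μ.real S := by
  choose! h hsub hh hμ using hM
  have hmono := dyadicChain_mono hS hh hsub
  refine ⟨fun t => ⋃ m : ℕ, dyadicChain h S m ⌊t * 2 ^ m⌋₊, ?_, ?_, ?_, ?_, ?_⟩
  · intro s t hst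
    exact iUnion_mono fun m => hmono m (by gcongr)
  · exact fun t => .iUnion fun m => measurableSet_dyadicChain hS hh m _
  · simp [dyadicChain_zero_right]
  · have (m : ℕ) : ⌊(1 : ℝ) * 2 ^ m⌋₊ = 2 ^ m := by
      rw [one_mul]
      exact_mod_cast Nat.floor_natCast (2 ^ m)
    simp only [this, dyadicChain_two_pow, iUnion_const]
  · rintro μ hμM t ⟨ht0, ht1⟩
    have := hfin μ hμM
    have hmono' : Monotone fun m : ℕ => dyadicChain h S m ⌊t * 2 ^ m⌋₊ := by
      refine monotone_nat_of_le_succ fun m => ?_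
      rw [← dyadicChain_succ_two_mul]
      refine hmono _ (Nat.le_floor ?_)
      have := Nat.floor_le (a := t * 2 ^ m) (by positivity)
      push_cast
      rw [pow_succ]
      linarith
    have h₁ := (ENNReal.tendsto_toReal (measure_ne_top μ _)).comp
      (tendsto_measure_iUnion_atTop (μ := μ) hmono')
    have h₂ : Tendsto (fun m : ℕ => (⌊t * 2 ^ m⌋₊ : ℝ) / 2 ^ m * μ.real S) atTop
        (𝓝 (t * μ.real S)) :=
      ((tendsto_nat_floor_mul_div_atTop ht0).comp
        (tendsto_pow_atTop_atTop_of_one_lt (one_lt_two : (1 : ℝ) < 2))).mul_const _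
    refine tendsto_nhds_unique h₁ (h₂.congr fun m => ?_)
    refine (measureReal_dyadicChain hS hh hsub μ (fun T hT => hμ T hT μ hμM) m _ ?_).symm
    refine Nat.floor_le_of_le ?_
    push_cast
    exact mul_le_of_le_one_left (by positivity) ht1

/-- A family of measures that can be halved simultaneously may be enlarged by any measure dominated
by one of its members. -/
theorem Halvable.insert {M : Set (Measure X)} (hM : Halvable M)
    (hfin : ∀ μ ∈ M, IsFiniteMeasure μ) {σ ν : Measure X} (hσ : σ ∈ M) (hν : ν ≤ σ) :
    Halvable (insert ν M) := by
  intro S hS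
  obtain ⟨A, hmono, hmeas, hA0, hA1, hA⟩ := hM.exists_chain hfin hS
  have := hfin σ hσ
  have : IsFiniteMeasure ν := isFiniteMeasure_of_le σ hν
  have hdiff {μ : Measure X} [IsFiniteMeasure μ] {s t : ℝ} (hst : s ≤ t) :
      μ.real (A t \ A s) = μ.real (A t) - μ.real (A s) :=
    measureReal_sdiff (hmono hst) (hmeas s)
  have hlip : LipschitzOnWith (σ.real S).toNNReal (fun t => ν.real (A t)) (Icc 0 1) := by
    refine LipschitzOnWith.of_le_add_mul _ fun t ht s hs => ?_
    rw [Real.coe_toNNReal _ measureReal_nonneg, Real.dist_eq]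
    rcases le_total s t with hst | hts
    · have h₁ : ν.real (A t \ A s) ≤ σ.real (A t \ A s) :=
        ENNReal.toReal_mono (measure_ne_top _ _) (hν _)
      rw [hdiff hst, hdiff hst, hA σ hσ t ht, hA σ hσ s hs] at h₁
      rw [abs_of_nonneg (sub_nonneg.2 hst)]
      linarith
    · have h₁ : ν.real (A t) ≤ ν.real (A s) := measureReal_mono (hmono hts)
      have h₂ : 0 ≤ σ.real S * |t - s| := by positivity
      linarith
  have hcont : ContinuousOn (fun t : ℝ => ν.real (A (t + 1 / 2)) - ν.real (A t))
      (Icc 0 (1 / 2)) := by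
    refine (hlip.continuousOn.comp (by fun_prop) ?_).sub (hlip.continuousOn.mono ?_)
    · rintro t ⟨h0, h1⟩
      constructor <;> linarith
    · exact Icc_subset_Icc_right (by norm_num)
  obtain ⟨t, ⟨ht0, ht1⟩, ht⟩ : ∃ t ∈ Icc (0 : ℝ) (1 / 2),
      ν.real (A (t + 1 / 2)) - ν.real (A t) = ν.real S / 2 := by
    have h₁ : ν.real (A (0 + 1 / 2)) - ν.real (A 0) = ν.real (A (1 / 2)) := by simp [hA0]
    have h₂ : ν.real (A (1 / 2 + 1 / 2)) - ν.real (A (1 / 2)) =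
        ν.real S - ν.real (A (1 / 2)) := by
      rw [add_halves, hA1]
    rcases le_total (ν.real (A (1 / 2))) (ν.real S / 2) with h | h
    · exact intermediate_value_Icc (by norm_num) hcont
        ⟨h₁.trans_le h, by rw [h₂]; linarith⟩
    · exact intermediate_value_Icc' (by norm_num) hcont
        ⟨by rw [h₂]; linarith, h.trans_eq h₁.symm⟩
  refine ⟨A (t + 1 / 2) \ A t, sdiff_subset.trans ?_, (hmeas _).diff (hmeas _), ?_⟩
  · rw [← hA1]
    exact hmono (by linarith)
  · rintro μ (rfl | hμ)
    · rw [hdiff (by linarith), ht]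
    · have := hfin μ hμ
      rw [hdiff (by linarith), hA μ hμ _ ⟨by linarith, by linarith⟩,
        hA μ hμ t ⟨ht0, by linarith⟩]
      ring

/-- A finite nonatomic measure on the unit interval can be halved on every measurable set. -/
theorem halvable_singleton (σ : Measure (Icc (0 : ℝ) 1)) [IsFiniteMeasure σ]
    [NullSingletonClass σ] : Halvable {σ} := by
  intro S hS
  let ρ : Measure ℝ := (σ.restrict S).map Subtype.val
  have hρ : NullSingletonClass ρ := by
    refine ⟨fun x => ?_⟩
    rw [Measure.map_apply measurable_subtype_coe (measurableSet_singleton x)]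
    exact (subsingleton_singleton.preimage Subtype.val_injective).measure_zero _
  have hF (t : ℝ) (ht : 0 ≤ t) :
      ∫ _ in (0 : ℝ)..t, (1 : ℝ) ∂ρ = σ.real (S ∩ Subtype.val ⁻¹' Iic t) := by
    have h₁ : ρ.real (Ioc 0 t) = ρ.real (Icc 0 t) := measureReal_congr Ioc_ae_eq_Icc
    rw [intervalIntegral.integral_of_le ht, setIntegral_const, smul_eq_mul, mul_one, h₁,
      map_measureReal_apply measurable_subtype_coe measurableSet_Icc,
      measureReal_restrict_apply (measurable_subtype_coe measurableSet_Icc), inter_comm]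
    congr 2
    ext x
    simp [x.2.1]
  have hcont : Continuous fun t => ∫ _ in (0 : ℝ)..t, (1 : ℝ) ∂ρ :=
    intervalIntegral.continuous_primitive (fun _ _ => intervalIntegrable_const) 0
  have h1 : ∫ _ in (0 : ℝ)..1, (1 : ℝ) ∂ρ = σ.real S := by
    rw [hF 1 zero_le_one]
    congr 1
    ext x
    simp [x.2.2]
  obtain ⟨t, ht, hhalf⟩ := intermediate_value_Icc zero_le_one hcont.continuousOn
    (show σ.real S / 2 ∈ Icc _ _ from by
      rw [h1, intervalIntegral.integral_same]
      constructor <;> linarith [measureReal_nonneg (μ := σ) (s := S)])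
  refine ⟨S ∩ Subtype.val ⁻¹' Iic t, inter_subset_left,
    hS.inter (measurable_subtype_coe measurableSet_Iic), ?_⟩
  rintro μ rfl
  rw [← hF t ht.1]
  exact hhalf

/-- A finite set of measures dominated by a finite nonatomic measure on the unit interval can be
halved simultaneously. -/
theorem halvable_of_forall_le (σ : Measure (Icc (0 : ℝ) 1)) [IsFiniteMeasure σ]
    [NullSingletonClass σ] {M : Set (Measure (Icc (0 : ℝ) 1))} (hM : M.Finite)
    (hle : ∀ μ ∈ M, μ ≤ σ) : Halvable (M ∪ {σ}) := by
  induction M, hM using Set.Finite.induction_on with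
  | empty => simpa using halvable_singleton σ
  | @insert ν M _ _ ih =>
    rw [insert_union]
    refine (ih fun μ hμ => hle μ (mem_insert_of_mem _ hμ)).insert (σ := σ) ?_ (by simp)
      (hle ν (mem_insert _ _))
    rintro μ (hμ | rfl)
    · exact isFiniteMeasure_of_le σ (hle μ (mem_insert_of_mem _ hμ))
    · infer_instance

/-- Finitely many finite nonatomic measures on the unit interval admit, for every `n ≥ 1`, a common
partition into `n` measurable pieces that each of the measures considers equal. -/
theorem exists_exact_partition {ι : Type*} [Fintype ι] (μ : ι → Measure (Icc (0 : ℝ) 1))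
    [∀ i, IsFiniteMeasure (μ i)] [∀ i, NullSingletonClass (μ i)] {n : ℕ} (hn : 1 ≤ n) :
    ∃ P : Fin n → Set (Icc (0 : ℝ) 1), (∀ j, MeasurableSet (P j)) ∧
      (Pairwise fun j k => Disjoint (P j) (P k)) ∧ (⋃ j, P j) = univ ∧
      ∀ i j, (μ i).real (P j) = (μ i).real univ / n := by
  let σ : Measure (Icc (0 : ℝ) 1) := ∑ i, μ i
  have hσ : NullSingletonClass σ := ⟨fun x => by simp [σ]⟩
  have hle : ∀ ν ∈ range μ, ν ≤ σ := by
    rintro _ ⟨i, rfl⟩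
    exact Finset.single_le_sum (f := μ) (fun _ _ => Measure.zero_le _) (Finset.mem_univ i)
  obtain ⟨A, hmono, hmeas, hA0, hA1, hA⟩ :=
    (halvable_of_forall_le σ (finite_range μ) hle).exists_chain (by
      rintro ν (hν | rfl)
      · exact isFiniteMeasure_of_le σ (hle ν hν)
      · infer_instance) MeasurableSet.univ
  have hn0 : (0 : ℝ) < n := by exact_mod_cast hn
  let B : ℕ → Set (Icc (0 : ℝ) 1) := fun k => A (k / n)
  have hB : Monotone B := fun j k hjk => hmono (by gcongr)
  have hμB (i : ι) (k : ℕ) (hk : k ≤ n) : (μ i).real (B k) = k / n * (μ i).real univ :=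
    hA _ (.inl ⟨i, rfl⟩) _ ⟨by positivity, (div_le_one hn0).2 (by exact_mod_cast hk)⟩
  refine ⟨fun j => B (j + 1) \ B j, fun j => (hmeas _).diff (hmeas _), ?_, ?_, ?_⟩
  · exact (pairwise_disjoint_on _).2 fun j k hjk =>
      disjoint_sdiff_right.mono_left (sdiff_subset.trans (hB (Nat.succ_le_of_lt hjk)))
  · refine eq_univ_of_forall fun x => ?_
    have hx : ∃ k, x ∈ B k := ⟨n, by simp [B, div_self hn0.ne', hA1]⟩
    classical
    have hpos : Nat.find hx ≠ 0 := fun h => by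
      have := Nat.find_spec hx
      simp [h, B, hA0] at this
    have hlen : Nat.find hx ≤ n := Nat.find_min' hx (by simp [B, div_self hn0.ne', hA1])
    refine mem_iUnion.2 ⟨⟨Nat.find hx - 1, by omega⟩, ?_, Nat.find_min hx (Nat.sub_one_lt hpos)⟩
    simpa [Nat.sub_add_cancel (Nat.one_le_iff_ne_zero.2 hpos)] using Nat.find_spec hx
  · intro i j
    rw [measureReal_sdiff (hB (Nat.le_succ _)) (hmeas _), hμB i _ j.2, hμB i _ j.2.le]
    push_cast
    ring

end ExactDivision

/-- For every `n ≥ 1` and every family of nonatomic Borel probability measures on the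
unit interval `[0,1]`, there exists a measurable partition `X 0, …, X (n-1)` of `[0,1]`
that is envy-free: `μ i (X i) ≥ μ i (X j)` for all `i j`. -/
theorem envy_free_partition_exists
    (n : ℕ) (hn : 1 ≤ n)
    (μ : Fin n → Measure (Set.Icc (0:ℝ) 1))
    (hprob : ∀ i, IsProbabilityMeasure (μ i))
    (hna : ∀ i, NoAtoms (μ i)) :
    ∃ X : Fin n → Set (Set.Icc (0:ℝ) 1),
      (∀ i, MeasurableSet (X i)) ∧
      (Pairwise fun i j => Disjoint (X i) (X j)) ∧
      (⋃ i, X i) = Set.univ ∧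
      (∀ i j, μ i (X j) ≤ μ i (X i)) := by
  have (i : Fin n) : NullSingletonClass (μ i) := hna i
  obtain ⟨P, hmeas, hdisj, hunion, hP⟩ := exists_exact_partition μ hn
  exact ⟨P, hmeas, hdisj, hunion, fun i j =>
    ((measureReal_eq_measureReal_iff).1 ((hP i j).trans (hP i i).symm)).le⟩
end

section
/- For every n ≥ 1 and every family of nonatomic Borel probability measures μ_1, …, μ_n on [0,1], there exist closed subintervals I_1, …, I_n of [0,1] with pairwise disjoint interiors such that μ_i(I_i) ≥ 1/(3n) for every agent i and μ_i(I_i) ≥ μ_i(I_j) for all i, j; that is, there is an envy-free partial allocation in which each agent receives a connected piece worth at least 1/(3n) of the whole cake to him. (This is the existence content of the ConnectedPieces Protocol.) -/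
open MeasureTheory
open scoped ENNReal

open Set Filter Topology ProbabilityTheory

/-- The cumulative distribution function of a nonatomic probability measure is continuous. -/
lemma continuous_cdf (ν : Measure ℝ) [IsProbabilityMeasure ν] [NullSingletonClass ν] :
    Continuous (cdf ν) := by
  refine continuous_iff_continuousAt.2 fun x => ?_
  rw [(monotone_cdf ν).continuousAt_iff_leftLim_eq_rightLim, StieltjesFunction.rightLim_eq]
  have h := (cdf ν).measure_singleton x
  rw [measure_cdf, measure_singleton, eq_comm, ENNReal.ofReal_eq_zero] at h
  exact le_antisymm ((monotone_cdf ν).leftLim_le le_rfl) (by linarith)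

lemma measureReal_Icc_eq_cdf_sub (ν : Measure ℝ) [IsProbabilityMeasure ν] [NullSingletonClass ν]
    {a b : ℝ} (hab : a ≤ b) : ν.real (Icc a b) = cdf ν b - cdf ν a := by
  have h : Function.leftLim (cdf ν) a = cdf ν a :=
    (continuous_cdf ν).continuousAt.continuousWithinAt.leftLim_eq
  rw [measureReal_def, ← measure_cdf ν, StieltjesFunction.measure_Icc, h,
    ENNReal.toReal_ofReal (sub_nonneg.2 (monotone_cdf ν hab)), measure_cdf]

/-- The pairs `p i` are the endpoints of closed subintervals of `[0,1]` with pairwise disjoint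
interiors. -/
def IsIntervalPacking {ι : Type*} (p : ι → ℝ × ℝ) : Prop :=
  (∀ i, 0 ≤ (p i).1 ∧ (p i).1 ≤ (p i).2 ∧ (p i).2 ≤ 1) ∧
    Pairwise fun i j => min (p i).2 (p j).2 ≤ max (p i).1 (p j).1

lemma isCompact_setOf_isIntervalPacking {ι : Type*} :
    IsCompact {p : ι → ℝ × ℝ | IsIntervalPacking p} := by
  refine (isCompact_univ_pi fun _ : ι =>
    (isCompact_Icc (a := (0 : ℝ)) (b := 1)).prod (isCompact_Icc (a := (0 : ℝ)) (b := 1))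
    ).of_isClosed_subset ?_ ?_
  · simp only [IsIntervalPacking, Pairwise, ofPred_and, ofPred_forall]
    refine (isClosed_iInter fun i => ?_).inter (isClosed_iInter fun i => isClosed_iInter fun j =>
      isClosed_iInter fun _ => ?_)
    · exact (isClosed_le (by fun_prop) (by fun_prop)).inter
        ((isClosed_le (by fun_prop) (by fun_prop)).inter
          (isClosed_le (by fun_prop) (by fun_prop)))
    · exact isClosed_le (by fun_prop) (by fun_prop)
  · intro p hp i _
    obtain ⟨h0, h1, h2⟩ := hp.1 i
    exact ⟨⟨h0, h1.trans h2⟩, ⟨h0.trans h1, h2⟩⟩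

/-- Moving a knife from `x` to the right, some agent `j` is the first to gain `ε`
over his threshold; at that moment no agent has gained more. -/
lemma exists_first_stop {ι : Type*} [Finite ι] {g : ι → ℝ → ℝ} (hg : ∀ i, Continuous (g i))
    {t : ι → ℝ} (ht : ∀ i, 0 ≤ t i) {x y : ℝ} (hxy : x ≤ y)
    (h : ∃ i, t i ≤ g i y - g i x) :
    ∃ z ∈ Icc x y, ∃ j, t j = g j z - g j x ∧ ∀ i, g i z - g i x ≤ t i := by
  have hclosed : IsClosed {z | ∃ i, t i ≤ g i z - g i x} := by
    simp only [ofPred_exists]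
    exact isClosed_iUnion_of_finite fun i =>
      isClosed_le continuous_const ((hg i).sub continuous_const)
  obtain ⟨z, ⟨hz, j, hj⟩, hmin⟩ := (isCompact_Icc.inter_right hclosed).exists_isLeast
    (⟨y, right_mem_Icc.2 hxy, h⟩ : (Icc x y ∩ {z | ∃ i, t i ≤ g i z - g i x}).Nonempty)
  have hle : ∀ i, g i z - g i x ≤ t i := by
    intro i
    by_contra! hi
    obtain ⟨w, hw, hwt⟩ := intermediate_value_Icc hz.1
      (f := fun w => g i w - g i x)
      ((hg i).sub continuous_const).continuousOn ⟨by simpa using ht i, hi.le⟩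
    have hzw : z ≤ w := hmin ⟨⟨hw.1, hw.2.trans hz.2⟩, i, hwt.ge⟩
    obtain rfl : w = z := le_antisymm hw.2 hzw
    exact hi.ne' hwt
  exact ⟨z, hz, j, le_antisymm hj (hle j), hle⟩

/-- For every `ε > 0` there is an interval packing in which no agent prefers another agent's
interval, or an unallocated interval, to his own by more than `ε`. -/
lemma exists_packing_approx_envyFree {ι : Type*} [Finite ι] {g : ι → ℝ → ℝ}
    (hg : ∀ i, Continuous (g i)) (hmono : ∀ i, Monotone (g i)) {ε : ℝ} (hε : 0 < ε) :
    ∃ p : ι → ℝ × ℝ, IsIntervalPacking p ∧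
      (∀ i j, g i (p j).2 - g i (p j).1 ≤ g i (p i).2 - g i (p i).1 + ε) ∧
      ∀ x y, 0 ≤ x → x ≤ y → y ≤ 1 → (∀ i, min (p i).2 y ≤ max (p i).1 x) →
        ∀ i, g i y - g i x ≤ g i (p i).2 - g i (p i).1 + ε := by
  classical
  have := Fintype.ofFinite ι
  set S : Set (ι → ℝ × ℝ) := {p | IsIntervalPacking p} ∩
    {p | ∀ i j, g i (p j).2 - g i (p j).1 ≤ g i (p i).2 - g i (p i).1 + ε}
  have hcomp : IsCompact S := by
    refine isCompact_setOf_isIntervalPacking.inter_right ?_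
    simp only [ofPred_forall]
    exact isClosed_iInter fun i => isClosed_iInter fun j =>
      isClosed_le (by fun_prop) (by fun_prop)
  have hne : S.Nonempty := by
    refine ⟨fun _ => (0, 0), ⟨fun i => by simp, fun i j _ => by simp⟩, fun i j => ?_⟩
    simpa using hε.le
  obtain ⟨p, ⟨hp, henvy⟩, hmax⟩ := hcomp.exists_isMaxOn hne
    (f := fun p => ∑ i, (g i (p i).2 - g i (p i).1)) (by fun_prop)
  refine ⟨p, hp, henvy, fun x y hx hxy hy hgap => ?_⟩
  by_contra! hlt
  obtain ⟨i₀, hi₀⟩ := hlt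
  have hv : ∀ i, 0 ≤ g i (p i).2 - g i (p i).1 := fun i => sub_nonneg.2 (hmono i (hp.1 i).2.1)
  obtain ⟨z, hz, j, hj, hle⟩ := exists_first_stop hg
    (t := fun i => g i (p i).2 - g i (p i).1 + ε) (fun i => by linarith [hv i]) hxy ⟨i₀, hi₀.le⟩
  have hgapz : ∀ i, min (p i).2 z ≤ max (p i).1 x := fun i =>
    (min_le_min_left _ hz.2).trans (hgap i)
  set q := Function.update p j (x, z)
  have hqj : q j = (x, z) := Function.update_self ..
  have hqi : ∀ i, i ≠ j → q i = p i := fun i hi => Function.update_of_ne hi ..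
  have hqval : ∀ i, g i (p i).2 - g i (p i).1 ≤ g i (q i).2 - g i (q i).1 := by
    intro i
    by_cases hi : i = j
    · subst hi
      rw [hqj]
      linarith
    · rw [hqi i hi]
  have hqS : q ∈ S := by
    refine ⟨⟨fun i => ?_, fun i k hik => ?_⟩, fun i k => ?_⟩
    · by_cases hi : i = j
      · rw [hi, hqj]
        exact ⟨hx, hz.1, hz.2.trans hy⟩
      · rw [hqi i hi]
        exact hp.1 i
    · change min (q i).2 (q k).2 ≤ max (q i).1 (q k).1
      by_cases hi : i = j
      · have hk : k ≠ j := fun hk => hik (hi.trans hk.symm)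
        rw [hi, hqj, hqi k hk, min_comm, max_comm]
        exact hgapz k
      · by_cases hk : k = j
        · rw [hk, hqj, hqi i hi]
          exact hgapz i
        · rw [hqi i hi, hqi k hk]
          exact hp.2 hik
    · have hi := hqval i
      by_cases hk : k = j
      · rw [hk, hqj]
        linarith [hle i]
      · rw [hqi k hk]
        linarith [henvy i k]
  have hsum : ∑ i, (g i (p i).2 - g i (p i).1) < ∑ i, (g i (q i).2 - g i (q i).1) := by
    refine Finset.sum_lt_sum (fun i _ => hqval i) ⟨j, Finset.mem_univ j, ?_⟩
    rw [hqj]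
    linarith
  exact (hmax hqS).not_gt hsum

/-- The unit interval is covered by the `n` intervals of a packing and `n + 1` intervals
that overlap none of them. -/
lemma IsIntervalPacking.exists_gaps {ι : Type*} [Fintype ι] {p : ι → ℝ × ℝ}
    (hp : IsIntervalPacking p) :
    ∃ l r : Option ι → ℝ, (∀ o, 0 ≤ l o ∧ r o ≤ 1) ∧
      (∀ o i, min (p i).2 (r o) ≤ max (p i).1 (l o)) ∧
      Icc (0 : ℝ) 1 ⊆ (⋃ i, Icc (p i).1 (p i).2) ∪ ⋃ o, Icc (l o) (r o) := by
  classical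
  let l : Option ι → ℝ := fun o => o.elim 0 fun i => (p i).2
  let u : ℝ → Option ι → ℝ := fun s o => o.elim 1 fun i => if s < (p i).2 then (p i).1 else 1
  let r : Option ι → ℝ := fun o => Finset.univ.inf' Finset.univ_nonempty (u (l o))
  refine ⟨l, r, fun o => ⟨?_, ?_⟩, fun o i => ?_, fun t ht => ?_⟩
  · cases o with
    | none => exact le_rfl
    | some i => exact (hp.1 i).1.trans (hp.1 i).2.1
  · exact Finset.inf'_le (u (l o)) (Finset.mem_univ none)
  · by_cases h : l o < (p i).2
    · have : r o ≤ u (l o) (some i) := Finset.inf'_le (u (l o)) (Finset.mem_univ _)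
      simp only [u, Option.elim_some, if_pos h] at this
      exact (min_le_right _ _).trans (this.trans (le_max_left _ _))
    · exact (min_le_left _ _).trans ((not_lt.1 h).trans (le_max_right _ _))
  · by_cases hpc : ∃ i, t ∈ Icc (p i).1 (p i).2
    · exact Or.inl (mem_iUnion.2 hpc)
    · right
      obtain ⟨o, ho, hmax⟩ := (Finset.univ.filter fun o => l o ≤ t).exists_max_image l
        ⟨none, by simpa [l] using ht.1⟩
      simp only [Finset.mem_filter, Finset.mem_univ, true_and] at ho hmax
      refine mem_iUnion.2 ⟨o, ho, Finset.le_inf' _ _ fun k _ => ?_⟩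
      cases k with
      | none => exact ht.2
      | some k =>
        simp only [u, Option.elim_some]
        split_ifs with h
        · by_contra! hlt
          refine hpc ⟨k, hlt.le, ?_⟩
          by_contra! hkt
          exact (hmax (some k) hkt.le).not_gt h
        · exact ht.2

/-- If no interval of a packing, and no interval that overlaps none of them, has mass more
than `c`, then `c` is at least `1 / (2 n + 1)`. -/
lemma IsIntervalPacking.one_le_mul {ι : Type*} [Fintype ι] {p : ι → ℝ × ℝ}
    (hp : IsIntervalPacking p) (ν : Measure ℝ) (hν : ν (Icc 0 1) = 1)
    [IsFiniteMeasure ν] {c : ℝ} (hc : 0 ≤ c) (hpiece : ∀ i, ν.real (Icc (p i).1 (p i).2) ≤ c)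
    (hgap : ∀ x y, 0 ≤ x → x ≤ y → y ≤ 1 → (∀ i, min (p i).2 y ≤ max (p i).1 x) →
      ν.real (Icc x y) ≤ c) :
    1 ≤ (2 * Fintype.card ι + 1) * c := by
  obtain ⟨l, r, hlr, hdisj, hcover⟩ := hp.exists_gaps
  have hgap' : ∀ o, ν.real (Icc (l o) (r o)) ≤ c := by
    intro o
    rcases le_or_gt (l o) (r o) with h | h
    · exact hgap _ _ (hlr o).1 h (hlr o).2 (hdisj o)
    · simpa [Icc_eq_empty h.not_ge] using hc
  calc
    1 = ν.real (Icc 0 1) := by simp [measureReal_def, hν]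
    _ ≤ ν.real ((⋃ i, Icc (p i).1 (p i).2) ∪ ⋃ o, Icc (l o) (r o)) := measureReal_mono hcover
    _ ≤ ∑ i, ν.real (Icc (p i).1 (p i).2) + ∑ o, ν.real (Icc (l o) (r o)) :=
      (measureReal_union_le _ _).trans
        (add_le_add (measureReal_iUnion_fintype_le _) (measureReal_iUnion_fintype_le _))
    _ ≤ ∑ _i : ι, c + ∑ _o : Option ι, c :=
      add_le_add (Finset.sum_le_sum fun i _ => hpiece i) (Finset.sum_le_sum fun o _ => hgap' o)
    _ = (2 * Fintype.card ι + 1) * c := by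
      simp
      ring

/-- Nonatomic probability measures on `[0,1]` admit an envy-free interval packing in which each
of the `n` agents gets at least `1 / (2 n + 1)`. -/
lemma exists_envyFree_packing {ι : Type*} [Fintype ι] (μ : ι → Measure ℝ)
    [∀ i, IsProbabilityMeasure (μ i)] [∀ i, NullSingletonClass (μ i)] (hμ : ∀ i, μ i (Icc 0 1) = 1) :
    ∃ p : ι → ℝ × ℝ, IsIntervalPacking p ∧
      (∀ i, 1 ≤ (2 * Fintype.card ι + 1) * (μ i).real (Icc (p i).1 (p i).2)) ∧
      ∀ i j, (μ i).real (Icc (p j).1 (p j).2) ≤ (μ i).real (Icc (p i).1 (p i).2) := by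
  have hg : ∀ i, Continuous (cdf (μ i)) := fun i => continuous_cdf (μ i)
  choose p hp henvy hgap using fun m : ℕ =>
    exists_packing_approx_envyFree hg (fun i => monotone_cdf (μ i))
      (Nat.one_div_pos_of_nat (α := ℝ) (n := m))
  obtain ⟨q, hq, φ, hφ, hlim⟩ := isCompact_setOf_isIntervalPacking.tendsto_subseq hp
  have hlim' : ∀ i j, Tendsto (fun m => cdf (μ i) (p (φ m) j).2 - cdf (μ i) (p (φ m) j).1) atTop
      (𝓝 (cdf (μ i) (q j).2 - cdf (μ i) (q j).1)) := by
    intro i j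
    have hcont : Continuous fun s : ι → ℝ × ℝ => cdf (μ i) (s j).2 - cdf (μ i) (s j).1 := by
      have := hg i
      fun_prop
    exact (hcont.tendsto q).comp hlim
  have hε : Tendsto (fun m => 1 / ((φ m : ℝ) + 1)) atTop (𝓝 0) :=
    tendsto_one_div_add_atTop_nhds_zero_nat.comp hφ.tendsto_atTop
  have hadd : ∀ i, Tendsto (fun m => cdf (μ i) (p (φ m) i).2 - cdf (μ i) (p (φ m) i).1 +
      1 / ((φ m : ℝ) + 1)) atTop (𝓝 (cdf (μ i) (q i).2 - cdf (μ i) (q i).1)) := fun i => by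
    simpa using (hlim' i i).add hε
  refine ⟨q, hq, fun i => ?_, fun i j => ?_⟩
  · rw [measureReal_Icc_eq_cdf_sub _ (hq.1 i).2.1]
    refine ge_of_tendsto' ((hadd i).const_mul _) fun m => ?_
    refine (hp (φ m)).one_le_mul (μ i) (hμ i) ?_ (fun j => ?_) fun x y hx hxy hy h => ?_
    · have := monotone_cdf (μ i) ((hp (φ m)).1 i).2.1
      have := Nat.one_div_pos_of_nat (α := ℝ) (n := φ m)
      linarith
    · rw [measureReal_Icc_eq_cdf_sub _ ((hp (φ m)).1 j).2.1]
      exact henvy (φ m) i j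
    · rw [measureReal_Icc_eq_cdf_sub _ hxy]
      exact hgap (φ m) x y hx hxy hy h i
  · rw [measureReal_Icc_eq_cdf_sub _ (hq.1 i).2.1, measureReal_Icc_eq_cdf_sub _ (hq.1 j).2.1]
    exact le_of_tendsto_of_tendsto' (hlim' i j) (hadd i) fun m => henvy (φ m) i j

/-- ConnectedPieces Protocol, existence content: for every `n ≥ 1` and nonatomic
Borel probability measures `μ i` concentrated on `[0,1]`, there are closed
subintervals `[a i, b i]` of `[0,1]` with pairwise disjoint interiors such that
each agent values his own interval at least `1/(3n)` and at least as much as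
every other agent's interval. -/
theorem connected_envy_free_partial_allocation_exists
    (n : ℕ) (hn : 1 ≤ n)
    (μ : Fin n → Measure ℝ)
    (hprob : ∀ i, IsProbabilityMeasure (μ i))
    (hsupp : ∀ i, μ i (Set.Icc (0:ℝ) 1) = 1)
    (hna : ∀ i, NoAtoms (μ i)) :
    ∃ a b : Fin n → ℝ,
      (∀ i, 0 ≤ a i ∧ a i ≤ b i ∧ b i ≤ 1) ∧
      (Pairwise fun i j =>
        Disjoint (interior (Set.Icc (a i) (b i))) (interior (Set.Icc (a j) (b j)))) ∧
      (∀ i, ((3 * n : ℕ) : ℝ≥0∞)⁻¹ ≤ μ i (Set.Icc (a i) (b i))) ∧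
      (∀ i j, μ i (Set.Icc (a j) (b j)) ≤ μ i (Set.Icc (a i) (b i))) := by
  have (i : Fin n) : NullSingletonClass (μ i) := hna i
  obtain ⟨p, hp, hval, henvy⟩ := exists_envyFree_packing μ hsupp
  refine ⟨fun i => (p i).1, fun i => (p i).2, hp.1, fun i j hij => ?_, fun i => ?_, fun i j => ?_⟩
  · simp only [interior_Icc, Ioo_disjoint_Ioo]
    exact hp.2 hij
  · have hn' : (1 : ℝ) ≤ n := by exact_mod_cast hn
    have h := hval i
    rw [Fintype.card_fin] at h
    have hle : ((3 * n : ℕ) : ℝ)⁻¹ ≤ (μ i).real (Icc (p i).1 (p i).2) := by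
      rw [inv_le_iff_one_le_mul₀ (by positivity)]
      push_cast
      nlinarith [measureReal_nonneg (μ := μ i) (s := Icc (p i).1 (p i).2)]
    rw [← ofReal_measureReal]
    refine le_trans (le_of_eq ?_) (ENNReal.ofReal_le_ofReal hle)
    rw [ENNReal.ofReal_inv_of_pos (by positivity), ENNReal.ofReal_natCast]
  · exact (ENNReal.toReal_le_toReal (measure_ne_top _ _) (measure_ne_top _ _)).1 (henvy i j)
end
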